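/- For every N ≥ 2 there exist analytic maps Φ₁, Φ₂: D^N → D^N with Φ₁(D^N) = Φ₂(D^N) such that C_{Φ₁} is compact on H²(D^N) with β_N^−(C_{Φ₁}) > 0 and β_N^+(C_{Φ₁}) < 1, while C_{Φ₂} is compact on H²(D^N) with β_N(C_{Φ₂}) = 0. -/

import Mathlib

open Complex MeasureTheory Set Filter
open scoped ENNReal Topology

noncomputable section

/-- The open unit disk in `ℂ`. -/
def unitDisk : Set ℂ := Metric.ball (0 : ℂ) 1

/-- A symbol: a non-constant analytic self-map of the unit disk. -/
structure IsSymbol (φ : ℂ → ℂ) : Prop where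
  mapsTo : Set.MapsTo φ unitDisk unitDisk
  diff : DifferentiableOn ℂ φ unitDisk
  nonconst : ¬ ∃ c : ℂ, Set.EqOn φ (fun _ => c) unitDisk

/-- `φ` is `p`-valent: every `w ∈ 𝔻` has at most `p` preimages in `𝔻`. -/
def Valent (φ : ℂ → ℂ) (p : ℕ) : Prop :=
  ∀ w ∈ unitDisk, (unitDisk ∩ φ ⁻¹' {w}).encard ≤ p

/-- The radial limit of `φ` at the boundary point `toCircle θ` exists and equals `w`.
The circle `𝕋` is parametrized by `AddCircle 1` (so that `volume` is the normalized
Haar measure `m`). -/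
def HasRadialLimit (φ : ℂ → ℂ) (θ : AddCircle (1 : ℝ)) (w : ℂ) : Prop :=
  Filter.Tendsto (fun r : ℝ => φ (r * (AddCircle.toCircle θ : ℂ)))
    (nhdsWithin 1 (Set.Iio 1)) (nhds w)

/-- The pull-back measure `m_φ(S) = m({ξ : φ*(ξ) ∈ S})`. -/
def pullbackMeasure (φ : ℂ → ℂ) (S : Set ℂ) : ℝ≥0∞ :=
  volume {θ : AddCircle (1 : ℝ) | ∃ w ∈ S, HasRadialLimit φ θ w}

/-- `ρ_φ(h) = sup_{ξ ∈ 𝕋} m_φ[S(ξ,h)]`, where `S(ξ,h) = {z : |z - ξ| ≤ h}`. -/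
def rho (φ : ℂ → ℂ) (h : ℝ) : ℝ≥0∞ :=
  ⨆ ξ : Circle, pullbackMeasure φ {z : ℂ | ‖z - (ξ : ℂ)‖ ≤ h}

/-- The `n`-th approximation number of a bounded operator between normed spaces:
the distance of `T` to operators of rank `< n`. -/
def approxNum {E F : Type*} [NormedAddCommGroup E] [NormedAddCommGroup F]
    [NormedSpace ℂ E] [NormedSpace ℂ F] (n : ℕ) (T : E →L[ℂ] F) : ℝ :=
  sInf {c : ℝ | ∃ R : E →L[ℂ] F,
    Module.rank ℂ (LinearMap.range (R : E →ₗ[ℂ] F)) < (n : Cardinal) ∧ c = ‖T - R‖}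

/-- The Hardy space `H²(𝔻)` in its coefficient model `ℓ²(ℕ)`. -/
abbrev H2 := lp (fun _ : ℕ => ℂ) 2

/-- The analytic function on `𝔻` associated with an element of `H²`. -/
def H2.eval (a : H2) (z : ℂ) : ℂ := ∑' n : ℕ, a n * z ^ n

/-- `T` is the composition operator with symbol `φ` on `H²(𝔻)`. -/
def IsCompOp (φ : ℂ → ℂ) (T : H2 →L[ℂ] H2) : Prop :=
  ∀ a : H2, ∀ z ∈ unitDisk, H2.eval (T a) z = H2.eval a (φ z)

/-- The open unit polydisk `𝔻^N`. -/
def polyDisk (N : ℕ) : Set (Fin N → ℂ) := {z | ∀ i, ‖z i‖ < 1}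

/-- The Hardy space `H²(𝔻^N)` in its coefficient model `ℓ²(ℕ^N)`. -/
abbrev H2poly (N : ℕ) := lp (fun _ : Fin N → ℕ => ℂ) 2

/-- The analytic function on `𝔻^N` associated with an element of `H²(𝔻^N)`. -/
def H2poly.eval {N : ℕ} (a : H2poly N) (z : Fin N → ℂ) : ℂ :=
  ∑' α : Fin N → ℕ, a α * ∏ i, z i ^ α i

/-- `T` is the composition operator with symbol `Φ` on `H²(𝔻^N)`. -/
def IsCompOpPoly {N : ℕ} (Φ : (Fin N → ℂ) → (Fin N → ℂ))
    (T : H2poly N →L[ℂ] H2poly N) : Prop :=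
  ∀ a : H2poly N, ∀ z ∈ polyDisk N, H2poly.eval (T a) z = H2poly.eval a (Φ z)

/-- The lens map `λ_θ`. -/
def lens (θ : ℝ) (z : ℂ) : ℂ :=
  ((1 + z) ^ (θ : ℂ) - (1 - z) ^ (θ : ℂ)) / ((1 + z) ^ (θ : ℂ) + (1 - z) ^ (θ : ℂ))

/-- The coefficients of the `n`-th power of the power series with coefficients `c`. -/
def powCoeff (c : ℕ → ℝ) (n j : ℕ) : ℝ := PowerSeries.coeff j ((PowerSeries.mk c) ^ n)

/-- The function on the closed disk with Taylor coefficients `c`. -/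
def seriesFun (c : ℕ → ℝ) (z : ℂ) : ℂ := ∑' j, (c j : ℂ) * z ^ j

theorem powCoeff_zero (c : ℕ → ℝ) (j : ℕ) : powCoeff c 0 j = if j = 0 then 1 else 0 := by
  simp [powCoeff, PowerSeries.coeff_one]

theorem powCoeff_succ (c : ℕ → ℝ) (n j : ℕ) :
    powCoeff c (n + 1) j =
      ∑ x ∈ Finset.HasAntidiagonal.antidiagonal j, powCoeff c n x.1 * c x.2 := by
  simp [powCoeff, pow_succ, PowerSeries.coeff_mul]

theorem powCoeff_nonneg {c : ℕ → ℝ} (h0 : ∀ j, 0 ≤ c j) (n j : ℕ) : 0 ≤ powCoeff c n j := by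
  induction n generalizing j with
  | zero => rw [powCoeff_zero]; split_ifs <;> norm_num
  | succ n ih =>
    rw [powCoeff_succ]
    exact Finset.sum_nonneg fun x _ => mul_nonneg (ih _) (h0 _)

theorem summable_norm_seriesFun {c : ℕ → ℝ} (h0 : ∀ j, 0 ≤ c j) (hc : Summable c) {z : ℂ}
    (hz : ‖z‖ ≤ 1) : Summable fun j => ‖(c j : ℂ) * z ^ j‖ := by
  refine Summable.of_nonneg_of_le (fun _ => norm_nonneg _) (fun j => ?_) hc
  rw [norm_mul, norm_pow, Complex.norm_real, Real.norm_of_nonneg (h0 j)]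
  exact mul_le_of_le_one_right (h0 j) (pow_le_one₀ (norm_nonneg _) hz)

theorem powCoeff_hasSum {c : ℕ → ℝ} (h0 : ∀ j, 0 ≤ c j) (hc : Summable c) {z : ℂ}
    (hz : ‖z‖ ≤ 1) (n : ℕ) :
    (Summable fun j => ‖(powCoeff c n j : ℂ) * z ^ j‖) ∧
      HasSum (fun j => (powCoeff c n j : ℂ) * z ^ j) (seriesFun c z ^ n) := by
  induction n with
  | zero =>
    have hfun : (fun j => (powCoeff c 0 j : ℂ) * z ^ j) = fun j => if j = 0 then 1 else 0 := by
      funext j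
      rw [powCoeff_zero]
      split_ifs with h <;> simp [h]
    have hs : HasSum (fun j : ℕ => if j = 0 then (1 : ℂ) else 0) 1 := hasSum_ite_eq 0 1
    have hs' : HasSum (fun j => (powCoeff c 0 j : ℂ) * z ^ j) (seriesFun c z ^ 0) := by
      rw [hfun, pow_zero]; exact hs
    exact ⟨hs'.summable.norm, hs'⟩
  | succ n ih =>
    have hg := summable_norm_seriesFun h0 hc hz
    have hfun : (fun j => (powCoeff c (n + 1) j : ℂ) * z ^ j) = fun j =>
        ∑ x ∈ Finset.HasAntidiagonal.antidiagonal j,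
          ((powCoeff c n x.1 : ℂ) * z ^ x.1) * ((c x.2 : ℂ) * z ^ x.2) := by
      funext j
      rw [powCoeff_succ]
      push_cast
      rw [Finset.sum_mul]
      refine Finset.sum_congr rfl fun x hx => ?_
      rw [← Finset.HasAntidiagonal.mem_antidiagonal.1 hx, pow_add]
      ring
    have hsum := summable_norm_sum_mul_antidiagonal_of_summable_norm ih.1 hg
    have heq := tsum_mul_tsum_eq_tsum_sum_antidiagonal_of_summable_norm ih.1 hg
    rw [ih.2.tsum_eq] at heq
    refine ⟨(summable_congr fun j => congrArg norm (congrFun hfun j)).2 hsum, ?_⟩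
    rw [hfun, pow_succ]
    have := hsum.of_norm.hasSum
    rwa [← heq] at this

theorem seriesFun_one {c : ℕ → ℝ} (hc : HasSum c 1) : seriesFun c 1 = 1 := by
  have : HasSum (fun j => (c j : ℂ)) ((1 : ℝ) : ℂ) := Complex.hasSum_ofReal.2 hc
  simpa [seriesFun] using this.tsum_eq

theorem powCoeff_hasSum_one {c : ℕ → ℝ} (h0 : ∀ j, 0 ≤ c j) (hc : HasSum c 1) (n : ℕ) :
    HasSum (powCoeff c n) 1 := by
  have := (powCoeff_hasSum h0 hc.summable (z := 1) (by simp) n).2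
  rw [seriesFun_one hc] at this
  have h : HasSum (fun j => (powCoeff c n j : ℂ)) ((1 : ℝ) : ℂ) := by simpa using this
  exact Complex.hasSum_ofReal.1 h

theorem powCoeff_le_one {c : ℕ → ℝ} (h0 : ∀ j, 0 ≤ c j) (hc : HasSum c 1) (n j : ℕ) :
    powCoeff c n j ≤ 1 :=
  le_hasSum (powCoeff_hasSum_one h0 hc n) j fun _ _ => powCoeff_nonneg h0 n _

theorem sum_antidiagonal_snd_le {g : ℕ → ℝ} {S : ℝ} (g0 : ∀ j, 0 ≤ g j) (hg : HasSum g S)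
    (j : ℕ) : ∑ x ∈ Finset.HasAntidiagonal.antidiagonal j, g x.2 ≤ S := by
  rw [Finset.Nat.sum_antidiagonal_eq_sum_range_succ_mk, ← Finset.sum_range_reflect]
  refine (Finset.sum_le_sum fun i hi => le_of_eq ?_).trans
    (sum_le_hasSum (Finset.range (j + 1)) (fun i _ => g0 i) hg)
  have := Finset.mem_range.1 hi
  congr 1
  simp only
  omega

theorem sum_antidiagonal_fst_le {g : ℕ → ℝ} {S : ℝ} (g0 : ∀ j, 0 ≤ g j) (hg : HasSum g S)
    (j : ℕ) : ∑ x ∈ Finset.HasAntidiagonal.antidiagonal j, g x.1 ≤ S := by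
  rw [Finset.Nat.sum_antidiagonal_eq_sum_range_succ_mk]
  exact sum_le_hasSum (Finset.range (j + 1)) (fun i _ => g0 i) hg

theorem powCoeff_le_of_le {c : ℕ → ℝ} (h0 : ∀ j, 0 ≤ c j) (hc : HasSum c 1) {B : ℝ} {n m : ℕ}
    (hB : ∀ j, powCoeff c n j ≤ B) (hnm : n ≤ m) (j : ℕ) : powCoeff c m j ≤ B := by
  induction m, hnm using Nat.le_induction generalizing j with
  | base => exact hB j
  | succ m _ ih =>
    have hB0 : 0 ≤ B := (powCoeff_nonneg h0 m 0).trans (ih 0)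
    rw [powCoeff_succ]
    calc ∑ x ∈ Finset.HasAntidiagonal.antidiagonal j, powCoeff c m x.1 * c x.2
        ≤ ∑ x ∈ Finset.HasAntidiagonal.antidiagonal j, B * c x.2 :=
          Finset.sum_le_sum fun x _ => mul_le_mul_of_nonneg_right (ih _) (h0 _)
      _ = B * ∑ x ∈ Finset.HasAntidiagonal.antidiagonal j, c x.2 := by rw [Finset.mul_sum]
      _ ≤ B := mul_le_of_le_one_right hB0 (sum_antidiagonal_snd_le h0 hc j)

/-- If the mass of `c` below `M` is `a` and all later coefficients are at most `b`, then the
coefficients of the `n`-th power are at most `a ^ n + n * b`. -/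
theorem powCoeff_le {c : ℕ → ℝ} (h0 : ∀ j, 0 ≤ c j) (hc : HasSum c 1) {M : ℕ} {b : ℝ}
    (hb0 : 0 ≤ b) (hb : ∀ j, M ≤ j → c j ≤ b) (n j : ℕ) :
    powCoeff c n j ≤ (∑ i ∈ Finset.range M, c i) ^ n + n * b := by
  set a := ∑ i ∈ Finset.range M, c i with ha
  have ha0 : 0 ≤ a := Finset.sum_nonneg fun i _ => h0 i
  have ha1 : a ≤ 1 := sum_le_hasSum _ (fun i _ => h0 i) hc
  induction n generalizing j with
  | zero => rw [powCoeff_zero]; split_ifs <;> simp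
  | succ n ih =>
    have hB0 : 0 ≤ a ^ n + n * b := by positivity
    rw [powCoeff_succ]
    calc ∑ x ∈ Finset.HasAntidiagonal.antidiagonal j, powCoeff c n x.1 * c x.2
        ≤ ∑ x ∈ Finset.HasAntidiagonal.antidiagonal j,
            ((a ^ n + n * b) * (if x.2 < M then c x.2 else 0) + powCoeff c n x.1 * b) := by
          refine Finset.sum_le_sum fun x _ => ?_
          have hp := powCoeff_nonneg h0 n x.1
          split_ifs with hx
          · have := mul_le_mul_of_nonneg_right (ih x.1) (h0 x.2)
            nlinarith [mul_nonneg hp hb0]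
          · have := mul_le_mul_of_nonneg_left (hb x.2 (not_lt.1 hx)) hp
            simpa using this
      _ = (a ^ n + n * b) * ∑ x ∈ Finset.HasAntidiagonal.antidiagonal j, (if x.2 < M then c x.2 else 0)
            + (∑ x ∈ Finset.HasAntidiagonal.antidiagonal j, powCoeff c n x.1) * b := by
          rw [Finset.sum_add_distrib, Finset.mul_sum, Finset.sum_mul]
      _ ≤ (a ^ n + n * b) * a + 1 * b := by
          refine add_le_add (mul_le_mul_of_nonneg_left ?_ hB0) (mul_le_mul_of_nonneg_right
            (sum_antidiagonal_fst_le (powCoeff_nonneg h0 n) (powCoeff_hasSum_one h0 hc n) j) hb0)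
          refine sum_antidiagonal_snd_le (g := fun i => if i < M then c i else 0) (fun i => ?_) ?_ j
          · split_ifs
            exacts [h0 i, le_rfl]
          · rw [ha, Finset.sum_congr rfl fun i hi => (if_pos (Finset.mem_range.1 hi)).symm]
            exact hasSum_sum_of_ne_finset_zero fun i hi => if_neg (by simpa using hi)
      _ ≤ a ^ (n + 1) + ((n + 1 : ℕ) : ℝ) * b := by
          have : n * b * a ≤ n * b := mul_le_of_le_one_right (by positivity) ha1
          push_cast
          nlinarith [pow_succ a n]

theorem powCoeff_sq_summable {c : ℕ → ℝ} (h0 : ∀ j, 0 ≤ c j) (hc : HasSum c 1) (n : ℕ) :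
    Summable fun j => powCoeff c n j ^ 2 := by
  refine Summable.of_nonneg_of_le (fun _ => sq_nonneg _) (fun j => ?_)
    (powCoeff_hasSum_one h0 hc n).summable
  nlinarith [powCoeff_nonneg h0 n j, powCoeff_le_one h0 hc n j]

theorem tsum_powCoeff_sq_le {c : ℕ → ℝ} (h0 : ∀ j, 0 ≤ c j) (hc : HasSum c 1) {B : ℝ} {n : ℕ}
    (hB : ∀ j, powCoeff c n j ≤ B) : ∑' j, powCoeff c n j ^ 2 ≤ B := by
  have h1 := powCoeff_hasSum_one h0 hc n
  calc ∑' j, powCoeff c n j ^ 2 ≤ ∑' j, B * powCoeff c n j := by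
        refine (powCoeff_sq_summable h0 hc n).tsum_le_tsum (fun j => ?_) (h1.summable.mul_left B)
        rw [sq]
        exact mul_le_mul_of_nonneg_right (hB j) (powCoeff_nonneg h0 n j)
    _ = B := by rw [tsum_mul_left, h1.tsum_eq, mul_one]

/-- A point evaluation at `x` bounds the `ℓ²` norm of the coefficients from below. -/
theorem le_tsum_powCoeff_sq {c : ℕ → ℝ} (h0 : ∀ j, 0 ≤ c j) (hc : HasSum c 1) {x y : ℝ}
    (hx0 : 0 ≤ x) (hx1 : x < 1) (hy0 : 0 ≤ y) {M : ℕ}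
    (hy : y ≤ (∑ i ∈ Finset.range M, c i) * x ^ M) (n : ℕ) :
    (y ^ n) ^ 2 * (1 - x) ≤ ∑' j, powCoeff c n j ^ 2 := by
  have hxn : ‖(x : ℂ)‖ ≤ 1 := by
    rw [Complex.norm_real, Real.norm_of_nonneg hx0]; exact hx1.le
  have hpow := fun n => (powCoeff_hasSum h0 hc.summable hxn n).2
  have hreal : ∃ t : ℝ, seriesFun c x = t ∧ HasSum (fun j => c j * x ^ j) t := by
    have hs : Summable fun j => c j * x ^ j := by
      refine Summable.of_nonneg_of_le (fun j => mul_nonneg (h0 j) (pow_nonneg hx0 j)) (fun j => ?_)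
        hc.summable
      exact mul_le_of_le_one_right (h0 j) (pow_le_one₀ hx0 hx1.le)
    refine ⟨_, ?_, hs.hasSum⟩
    rw [seriesFun, Complex.ofReal_tsum]
    push_cast
    rfl
  obtain ⟨t, ht, hts⟩ := hreal
  have hyt : y ≤ t := by
    refine hy.trans (le_trans ?_ (sum_le_hasSum (Finset.range M)
      (fun j _ => mul_nonneg (h0 j) (pow_nonneg hx0 j)) hts))
    rw [Finset.sum_mul]
    refine Finset.sum_le_sum fun i hi => mul_le_mul_of_nonneg_left ?_ (h0 i)
    exact pow_le_pow_of_le_one hx0 hx1.le (Finset.mem_range.1 hi).le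
  have hp : HasSum (fun j => powCoeff c n j * x ^ j) (t ^ n) := by
    have := hpow n
    rw [ht] at this
    exact_mod_cast this
  have hgeo : HasSum (fun j => (x ^ j) ^ 2) (1 - x ^ 2)⁻¹ := by
    simpa [← pow_mul, mul_comm] using hasSum_geometric_of_lt_one (sq_nonneg x)
      (by nlinarith : x ^ 2 < 1)
  have hsq := powCoeff_sq_summable h0 hc n
  have hcs : (t ^ n) ^ 2 ≤ (∑' j, powCoeff c n j ^ 2) * (1 - x ^ 2)⁻¹ := by
    have hlim : Tendsto (fun K => (∑ j ∈ Finset.range K, powCoeff c n j * x ^ j) ^ 2) atTop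
        (𝓝 ((t ^ n) ^ 2)) := hp.tendsto_sum_nat.pow 2
    refine le_of_tendsto' hlim fun K => (Finset.sum_mul_sq_le_sq_mul_sq _ _ _).trans ?_
    exact mul_le_mul (hsq.sum_le_tsum _ fun _ _ => sq_nonneg _)
      (sum_le_hasSum _ (fun _ _ => sq_nonneg _) hgeo)
      (Finset.sum_nonneg fun _ _ => sq_nonneg _) (tsum_nonneg fun _ => sq_nonneg _)
  have hpos : 0 < 1 - x ^ 2 := by nlinarith
  rw [← div_eq_mul_inv, le_div_iff₀ hpos] at hcs
  refine le_trans (mul_le_mul ?_ ?_ (by linarith) (sq_nonneg _)) hcs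
  · exact pow_le_pow_left₀ (pow_nonneg hy0 n) (pow_le_pow_left₀ hy0 hyt n) 2
  · nlinarith

theorem norm_seriesFun_le {c : ℕ → ℝ} (h0 : ∀ j, 0 ≤ c j) (hc : HasSum c 1) {z : ℂ}
    (hz : ‖z‖ ≤ 1) : ‖seriesFun c z‖ ≤ 1 := by
  refine tsum_of_norm_bounded hc fun j => ?_
  rw [norm_mul, norm_pow, Complex.norm_real, Real.norm_of_nonneg (h0 j)]
  exact mul_le_of_le_one_right (h0 j) (pow_le_one₀ (norm_nonneg _) hz)

theorem differentiableOn_seriesFun {c : ℕ → ℝ} (h0 : ∀ j, 0 ≤ c j) (hc : HasSum c 1) :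
    DifferentiableOn ℂ (seriesFun c) unitDisk := by
  refine Complex.differentiableOn_tsum_of_summable_norm hc.summable
    (fun j => (by fun_prop)) Metric.isOpen_ball fun j z hz => ?_
  rw [norm_mul, norm_pow, Complex.norm_real, Real.norm_of_nonneg (h0 j)]
  exact mul_le_of_le_one_right (h0 j) (pow_le_one₀ (norm_nonneg _) (by simpa using hz.out.le))

theorem exists_norm_seriesFun_gt {c : ℕ → ℝ} (h0 : ∀ j, 0 ≤ c j) (hc : HasSum c 1) {r : ℝ}
    (hr : r < 1) : ∃ z : ℂ, ‖z‖ < 1 ∧ r < ‖seriesFun c z‖ := by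
  have hcont : ContinuousOn (fun z : ℂ => ‖seriesFun c z‖) (Metric.closedBall 0 1) := by
    refine (continuousOn_tsum (fun j => by fun_prop) hc.summable fun j z hz => ?_).norm
    rw [norm_mul, norm_pow, Complex.norm_real, Real.norm_of_nonneg (h0 j)]
    exact mul_le_of_le_one_right (h0 j) (pow_le_one₀ (norm_nonneg _) (by simpa using hz))
  have h1 : Tendsto (fun x : ℝ => ‖seriesFun c x‖) (𝓝[<] 1) (𝓝 1) := by
    have h := hcont 1 (by simp)
    have hval : ‖seriesFun c 1‖ = 1 := by rw [seriesFun_one hc, norm_one]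
    rw [ContinuousWithinAt, hval] at h
    refine h.comp (tendsto_nhdsWithin_iff.2 ⟨?_, ?_⟩)
    · have : Tendsto (fun x : ℝ => (x : ℂ)) (𝓝 1) (𝓝 ((1 : ℝ) : ℂ)) :=
        Complex.continuous_ofReal.tendsto 1
      simpa using this.mono_left nhdsWithin_le_nhds
    · filter_upwards [Ioo_mem_nhdsLT (show (0 : ℝ) < 1 by norm_num)] with x hx
      simp [Complex.norm_real, abs_of_pos hx.1, hx.2.le]
  obtain ⟨x, hx, hxr⟩ := (Eventually.and
    (Ioo_mem_nhdsLT (show (0 : ℝ) < 1 by norm_num)) (h1.eventually_const_lt hr)).exists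
  exact ⟨x, by simpa [Complex.norm_real, abs_of_pos hx.1] using hx.2, hxr⟩

theorem lp_two_hasSum {I : Type*} (f : lp (fun _ : I => ℂ) 2) :
    HasSum (fun i => ‖f i‖ ^ 2) (‖f‖ ^ 2) := by
  simpa using lp.hasSum_norm (p := 2) (by simp) f

theorem summable_comp_sq {I : Type*} {e : ℕ → I} (he : e.Injective)
    (f : lp (fun _ : I => ℂ) 2) : Summable fun m => ‖f (e m)‖ ^ 2 :=
  (lp_two_hasSum f).summable.comp_injective he

theorem tsum_comp_sq_le {I : Type*} {e : ℕ → I} (he : e.Injective)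
    (f : lp (fun _ : I => ℂ) 2) : ∑' m, ‖f (e m)‖ ^ 2 ≤ ‖f‖ ^ 2 :=
  (lp_two_hasSum f).tsum_eq ▸
    tsum_comp_le_tsum_of_inj (lp_two_hasSum f).summable (fun _ => sq_nonneg _) he

/-- The operator sending the coordinate `e m` to the vector with coordinates `p m j` at `ι (m, j)`;
these vectors are pairwise orthogonal. -/
theorem exists_blockDiagonal {I : Type*} {e : ℕ → I} {ι : ℕ × ℕ → I} (he : e.Injective)
    (hι : ι.Injective) {p : ℕ → ℕ → ℝ} (hs : ∀ m, Summable fun j => p m j ^ 2)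
    (h1 : ∀ m, ∑' j, p m j ^ 2 ≤ 1) :
    ∃ T : lp (fun _ : I => ℂ) 2 →L[ℂ] lp (fun _ : I => ℂ) 2,
      (∀ a, ⇑(T a) = Function.extend ι (fun x => a (e x.1) * (p x.1 x.2 : ℂ)) 0) ∧
      ∀ a, HasSum (fun m => ‖a (e m)‖ ^ 2 * ∑' j, p m j ^ 2) (‖T a‖ ^ 2) := by
  have hsq : ∀ a : lp (fun _ : I => ℂ) 2, ∀ x : ℕ × ℕ,
      ‖a (e x.1) * (p x.1 x.2 : ℂ)‖ ^ 2 = ‖a (e x.1)‖ ^ 2 * p x.1 x.2 ^ 2 := by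
    intro a x
    rw [norm_mul, mul_pow, Complex.norm_real, Real.norm_eq_abs, sq_abs]
  have hfib : ∀ (a : lp (fun _ : I => ℂ) 2) (m : ℕ),
      HasSum (fun j => ‖a (e m)‖ ^ 2 * p m j ^ 2) (‖a (e m)‖ ^ 2 * ∑' j, p m j ^ 2) :=
    fun a m => (hs m).hasSum.mul_left _
  have hsum : ∀ a : lp (fun _ : I => ℂ) 2,
      Summable fun x : ℕ × ℕ => ‖a (e x.1)‖ ^ 2 * p x.1 x.2 ^ 2 := by
    intro a
    refine (summable_prod_of_nonneg fun x => by positivity).2 ⟨fun m => (hfib a m).summable, ?_⟩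
    refine Summable.of_nonneg_of_le (fun m => tsum_nonneg fun j => by positivity) (fun m => ?_)
      (summable_comp_sq he a)
    simp only [(hfib a m).tsum_eq]
    exact mul_le_of_le_one_right (sq_nonneg _) (h1 m)
  have hext : ∀ a : lp (fun _ : I => ℂ) 2,
      (fun i => ‖Function.extend ι (fun x => a (e x.1) * (p x.1 x.2 : ℂ)) 0 i‖ ^ 2) =
        Function.extend ι (fun x : ℕ × ℕ => ‖a (e x.1)‖ ^ 2 * p x.1 x.2 ^ 2) 0 := by
    intro a
    funext i
    by_cases hi : ∃ x, ι x = i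
    · obtain ⟨x, rfl⟩ := hi
      rw [hι.extend_apply, hι.extend_apply, hsq]
    · simp [Function.extend_apply' _ _ _ hi]
  have hmem : ∀ a : lp (fun _ : I => ℂ) 2,
      Memℓp (Function.extend ι (fun x => a (e x.1) * (p x.1 x.2 : ℂ)) 0 : I → ℂ) 2 := by
    intro a
    rw [memℓp_gen_iff (by simp)]
    have := ((hasSum_extend_zero hι).2 (hsum a).hasSum).summable
    rw [← hext a] at this
    simpa using this
  have hadd : ∀ a b : lp (fun _ : I => ℂ) 2,
      (Function.extend ι (fun x => (a + b) (e x.1) * (p x.1 x.2 : ℂ)) 0 : I → ℂ) =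
        Function.extend ι (fun x => a (e x.1) * (p x.1 x.2 : ℂ)) 0 +
          Function.extend ι (fun x => b (e x.1) * (p x.1 x.2 : ℂ)) 0 := by
    intro a b
    funext i
    rw [Pi.add_apply]
    by_cases hi : ∃ x, ι x = i
    · obtain ⟨x, rfl⟩ := hi
      simp [hι.extend_apply, add_mul]
    · simp [Function.extend_apply' _ _ _ hi]
  let L : lp (fun _ : I => ℂ) 2 →ₗ[ℂ] lp (fun _ : I => ℂ) 2 :=
    { toFun := fun a => ⟨_, hmem a⟩
      map_add' := fun a b => Subtype.ext (hadd a b)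
      map_smul' := fun t a => by
        ext i
        by_cases hi : ∃ x, ι x = i
        · obtain ⟨x, rfl⟩ := hi
          simp [hι.extend_apply, mul_assoc]
        · simp [Function.extend_apply' _ _ _ hi] }
  have hL : ∀ a, HasSum (fun m => ‖a (e m)‖ ^ 2 * ∑' j, p m j ^ 2) (‖L a‖ ^ 2) := by
    intro a
    have h := lp_two_hasSum (L a)
    have h2 : (fun i => ‖L a i‖ ^ 2) = _ := hext a
    rw [h2, hasSum_extend_zero hι] at h
    exact h.prod_fiberwise (hfib a)
  refine ⟨L.mkContinuous 1 fun a => ?_, fun a => rfl, hL⟩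
  rw [one_mul]
  refine le_of_sq_le_sq ?_ (norm_nonneg _)
  refine le_trans ?_ (tsum_comp_sq_le he a)
  rw [← (hL a).tsum_eq]
  exact (hL a).summable.tsum_le_tsum
    (fun m => mul_le_of_le_one_right (sq_nonneg _) (h1 m)) (summable_comp_sq he a)

theorem approxNum_nonneg {E F : Type*} [NormedAddCommGroup E] [NormedAddCommGroup F]
    [NormedSpace ℂ E] [NormedSpace ℂ F] (n : ℕ) (T : E →L[ℂ] F) : 0 ≤ approxNum n T :=
  Real.sInf_nonneg <| by
    rintro _ ⟨R, -, rfl⟩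
    exact norm_nonneg _

theorem approxNum_le {E F : Type*} [NormedAddCommGroup E] [NormedAddCommGroup F]
    [NormedSpace ℂ E] [NormedSpace ℂ F] {n : ℕ} {T R : E →L[ℂ] F} {C : ℝ}
    (hR : Module.rank ℂ (LinearMap.range (R : E →ₗ[ℂ] F)) < (n : Cardinal)) (h : ‖T - R‖ ≤ C) :
    approxNum n T ≤ C := by
  unfold approxNum
  refine le_trans (csInf_le ⟨0, ?_⟩ ⟨R, hR, rfl⟩) h
  rintro _ ⟨R, -, rfl⟩
  exact norm_nonneg _

theorem le_approxNum {E F : Type*} [NormedAddCommGroup E] [NormedAddCommGroup F]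
    [NormedSpace ℂ E] [NormedSpace ℂ F] {n : ℕ} {T : E →L[ℂ] F} {C : ℝ}
    (h : ∀ R : E →L[ℂ] F, Module.rank ℂ (LinearMap.range (R : E →ₗ[ℂ] F)) < ((n + 1 : ℕ) : Cardinal) →
      C ≤ ‖T - R‖) :
    C ≤ approxNum (n + 1) T := by
  refine le_csInf ⟨‖T - 0‖, 0, ?_, rfl⟩ ?_
  · rw [ContinuousLinearMap.toLinearMap_zero, LinearMap.range_zero, rank_bot]
    exact_mod_cast Nat.succ_pos n
  · rintro c ⟨R, hR, rfl⟩
    exact h R hR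

theorem isCompactOperator_of_tendsto_approxNum {E F : Type*} [NormedAddCommGroup E]
    [NormedAddCommGroup F] [NormedSpace ℂ E] [NormedSpace ℂ F] [CompleteSpace F] {T : E →L[ℂ] F}
    (h : Tendsto (fun n => approxNum (n + 1) T) atTop (𝓝 0)) : IsCompactOperator ⇑T := by
  have hex : ∀ k : ℕ, ∃ R : E →L[ℂ] F, IsCompactOperator ⇑R ∧ ‖T - R‖ < 1 / ((k : ℝ) + 1) := by
    intro k
    obtain ⟨n, hn⟩ := (h.eventually_lt_const (Nat.one_div_pos_of_nat (n := k))).exists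
    obtain ⟨R, hR, hlt⟩ : ∃ R : E →L[ℂ] F,
        Module.rank ℂ (LinearMap.range (R : E →ₗ[ℂ] F)) < ((n + 1 : ℕ) : Cardinal) ∧
          ‖T - R‖ < 1 / ((k : ℝ) + 1) := by
      by_contra! hcon
      exact hn.not_ge (le_approxNum hcon)
    refine ⟨R, ?_, hlt⟩
    have hfin : FiniteDimensional ℂ (LinearMap.range (R : E →ₗ[ℂ] F)) :=
      Module.rank_lt_aleph0_iff.1 (hR.trans (Cardinal.natCast_lt_aleph0))
    have : ProperSpace (LinearMap.range (R : E →ₗ[ℂ] F)) := FiniteDimensional.proper ℂ _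
    have hc : IsCompactOperator (R.codRestrict (LinearMap.range (R : E →ₗ[ℂ] F)) fun x => ⟨x, rfl⟩) :=
      isCompactOperator_of_locallyCompactSpace_dom _
    exact hc.clm_comp (LinearMap.range (R : E →ₗ[ℂ] F)).subtypeL
  choose R hR hlt using hex
  refine isCompactOperator_of_tendsto (F := R) (l := atTop) ?_ (Eventually.of_forall hR)
  rw [tendsto_iff_norm_sub_tendsto_zero]
  refine squeeze_zero (fun _ => norm_nonneg _) (fun k => ?_) tendsto_one_div_add_atTop_nhds_zero_nat
  rw [norm_sub_rev]
  exact (hlt k).le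

theorem approxNum_le_of_hasSum {I : Type*} {e : ℕ → I} (he : e.Injective) {s : ℕ → ℝ}
    {T : lp (fun _ : I => ℂ) 2 →L[ℂ] lp (fun _ : I => ℂ) 2}
    (hT : ∀ a, HasSum (fun m => ‖a (e m)‖ ^ 2 * s m) (‖T a‖ ^ 2)) {n : ℕ} {B : ℝ}
    (hB0 : 0 ≤ B) (hB : ∀ m, n ≤ m → s m ≤ B) : approxNum (n + 1) T ≤ √B := by
  classical
  let u : ℕ → lp (fun _ : I => ℂ) 2 := fun m => lp.single 2 (e m) 1
  let Q : lp (fun _ : I => ℂ) 2 →L[ℂ] lp (fun _ : I => ℂ) 2 :=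
    ∑ m ∈ Finset.range n, (lp.evalCLM ℂ (fun _ : I => ℂ) 2 (e m)).smulRight (u m)
  have hQ : ∀ a, Q a = ∑ m ∈ Finset.range n, a (e m) • u m := fun a => by
    simp only [Q, sum_apply, ContinuousLinearMap.smulRight_apply]
    rfl
  have hQe : ∀ a m, Q a (e m) = if m < n then a (e m) else 0 := by
    intro a m
    rw [hQ]
    simp only [u, lp.coeFn_sum, Finset.sum_apply, lp.coeFn_smul, Pi.smul_apply, lp.single_apply,
      Pi.single_apply, he.eq_iff, smul_eq_mul, mul_ite, mul_one, mul_zero, Finset.sum_ite_eq,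
      Finset.mem_range]
  refine approxNum_le (R := T.comp Q) ?_ (ContinuousLinearMap.opNorm_le_bound _ (Real.sqrt_nonneg _)
    fun a => ?_)
  · refine lt_of_le_of_lt ?_ (Nat.cast_lt.2 (Nat.lt_succ_self n))
    have hle : LinearMap.range (T.comp Q : lp (fun _ : I => ℂ) 2 →ₗ[ℂ] lp (fun _ : I => ℂ) 2) ≤
        Submodule.span ℂ (((Finset.range n).image fun m => T (u m) : Finset _) : Set _) := by
      rintro _ ⟨a, rfl⟩
      have : T (Q a) = ∑ m ∈ Finset.range n, a (e m) • T (u m) := by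
        rw [hQ, map_sum]; simp
      change T (Q a) ∈ _
      rw [this]
      exact Submodule.sum_mem _ fun m hm => Submodule.smul_mem _ _
        (Submodule.subset_span (Finset.mem_coe.2 (Finset.mem_image_of_mem _ hm)))
    refine (Submodule.rank_mono hle).trans ((rank_span_finset_le _).trans ?_)
    exact_mod_cast Finset.card_image_le.trans (Finset.card_range n).le
  · have hTa : (T - T.comp Q) a = T (a - Q a) := by simp
    rw [hTa]
    refine le_of_sq_le_sq ?_ (by positivity)
    rw [mul_pow, Real.sq_sqrt hB0, ← (hT _).tsum_eq]
    refine le_trans ?_ (mul_le_mul_of_nonneg_left (tsum_comp_sq_le he a) hB0)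
    rw [← tsum_mul_left]
    refine (hT _).summable.tsum_le_tsum (fun m => ?_) ((summable_comp_sq he a).mul_left B)
    rw [lp.coeFn_sub, Pi.sub_apply, hQe]
    split_ifs with hm
    · simpa using mul_nonneg hB0 (sq_nonneg _)
    · rw [sub_zero, mul_comm]
      exact mul_le_mul_of_nonneg_right (hB m (not_lt.1 hm)) (sq_nonneg _)

theorem le_approxNum_of_hasSum {I : Type*} {e : ℕ → I} (he : e.Injective) {s : ℕ → ℝ}
    {T : lp (fun _ : I => ℂ) 2 →L[ℂ] lp (fun _ : I => ℂ) 2}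
    (hT : ∀ a, HasSum (fun m => ‖a (e m)‖ ^ 2 * s m) (‖T a‖ ^ 2)) {n : ℕ} {b : ℝ}
    (hb : ∀ m, m ≤ n → b ^ 2 ≤ s m) : b ≤ approxNum (n + 1) T := by
  classical
  refine le_approxNum fun R hR => ?_
  let V : (Fin (n + 1) → ℂ) →ₗ[ℂ] lp (fun _ : I => ℂ) 2 :=
    ∑ i : Fin (n + 1), (LinearMap.proj i).smulRight (lp.single 2 (e i) (1 : ℂ))
  have hVi : ∀ v i, V v i = ∑ k : Fin (n + 1), v k * (if i = e k then 1 else 0) := by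
    intro v i
    simp only [V, LinearMap.sum_apply, LinearMap.smulRight_apply, LinearMap.proj_apply,
      lp.coeFn_sum, Finset.sum_apply, lp.coeFn_smul, Pi.smul_apply, lp.single_apply,
      Pi.single_apply, smul_eq_mul]
  have hVe : ∀ v (k : Fin (n + 1)), V v (e k) = v k := by
    intro v k
    rw [hVi]
    simp [he.eq_iff, Fin.val_inj]
  have hVsupp : ∀ v i, (∀ k : Fin (n + 1), i ≠ e k) → V v i = 0 := by
    intro v i hi
    rw [hVi]
    simp [hi]
  have hker : ∃ v, v ≠ 0 ∧ R (V v) = 0 := by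
    by_contra! hcon
    let G : (Fin (n + 1) → ℂ) →ₗ[ℂ] 
        LinearMap.range (R : lp (fun _ : I => ℂ) 2 →ₗ[ℂ] lp (fun _ : I => ℂ) 2) :=
      (R : lp (fun _ : I => ℂ) 2 →ₗ[ℂ] lp (fun _ : I => ℂ) 2).rangeRestrict ∘ₗ V
    have hG : Function.Injective G := by
      rw [injective_iff_map_eq_zero]
      intro v hv
      by_contra hne
      exact hcon v hne (congrArg Subtype.val hv)
    have := LinearMap.lift_rank_le_of_injective G hG
    rw [rank_fin_fun] at this
    have h2 := (Cardinal.lift_lt.2 hR).trans_le' this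
    simp at h2
  obtain ⟨v, hv0, hRv⟩ := hker
  set x := V v with hx
  have hx0 : x ≠ 0 := by
    intro h
    refine hv0 (funext fun k => ?_)
    rw [← hVe v k, ← hx, h]
    rfl
  have hnx : HasSum (fun m => ‖x (e m)‖ ^ 2) (‖x‖ ^ 2) := by
    have h := lp_two_hasSum x
    refine (he.hasSum_iff fun i hi => ?_).2 h
    have : x i = 0 := hVsupp v i fun k hk => hi ⟨k, hk.symm⟩
    simp [this]
  have hle : b * ‖x‖ ≤ ‖T x‖ := by
    refine le_of_sq_le_sq ?_ (norm_nonneg _)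
    rw [mul_pow]
    refine hasSum_le (fun m => ?_) (hnx.mul_left (b ^ 2)) (hT x)
    rcases le_or_gt m n with hm | hm
    · rw [mul_comm]
      exact mul_le_mul_of_nonneg_left (hb m hm) (sq_nonneg _)
    · have : x (e m) = 0 := hVsupp v (e m) fun k hk => by
        have := he hk
        omega
      simp [this]
  have hTR : ‖T x‖ ≤ ‖T - R‖ * ‖x‖ := by
    have := (T - R).le_opNorm x
    rwa [sub_apply, hRv, sub_zero] at this
  exact le_of_mul_le_mul_right (hle.trans hTR) (norm_pos_iff.2 hx0)

/-- The self-map `z ↦ (z₀ ψ(z₁), 0, …, 0)` of the polydisk, `ψ` having Taylor coefficients `c`. -/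
def symbolMap (M : ℕ) (c : ℕ → ℝ) (z : Fin (M + 2) → ℂ) : Fin (M + 2) → ℂ :=
  Matrix.vecCons (z 0 * seriesFun c (z 1)) 0

theorem norm_mul_seriesFun_lt {c : ℕ → ℝ} (h0 : ∀ j, 0 ≤ c j) (hc : HasSum c 1) {u v : ℂ}
    (hu : ‖u‖ < 1) (hv : ‖v‖ < 1) : ‖u * seriesFun c v‖ < 1 := by
  rw [norm_mul]
  exact (mul_le_of_le_one_right (norm_nonneg _) (norm_seriesFun_le h0 hc hv.le)).trans_lt hu

theorem mapsTo_symbolMap (M : ℕ) {c : ℕ → ℝ} (h0 : ∀ j, 0 ≤ c j) (hc : HasSum c 1) :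
    Set.MapsTo (symbolMap M c) (polyDisk (M + 2)) (polyDisk (M + 2)) := by
  intro z hz i
  refine Fin.cases ?_ (fun i => ?_) i
  · simpa [symbolMap] using norm_mul_seriesFun_lt h0 hc (hz 0) (hz 1)
  · simp [symbolMap]

theorem differentiableOn_symbolMap (M : ℕ) {c : ℕ → ℝ} (h0 : ∀ j, 0 ≤ c j) (hc : HasSum c 1) :
    DifferentiableOn ℂ (symbolMap M c) (polyDisk (M + 2)) := by
  rw [differentiableOn_pi]
  intro i
  refine Fin.cases ?_ (fun i => ?_) i
  · simp only [symbolMap, Matrix.cons_val_zero]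
    refine DifferentiableOn.mul (by fun_prop)
      ((differentiableOn_seriesFun h0 hc).comp (by fun_prop) fun z hz => ?_)
    simpa [unitDisk] using hz 1
  · simp [symbolMap]

theorem image_symbolMap (M : ℕ) {c : ℕ → ℝ} (h0 : ∀ j, 0 ≤ c j) (hc : HasSum c 1) :
    symbolMap M c '' polyDisk (M + 2) = (fun w : ℂ => Matrix.vecCons w 0) '' unitDisk := by
  ext y
  constructor
  · rintro ⟨z, hz, rfl⟩
    exact ⟨_, by simpa [unitDisk] using norm_mul_seriesFun_lt h0 hc (hz 0) (hz 1), rfl⟩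
  · rintro ⟨w, hw, rfl⟩
    have hw1 : ‖w‖ < 1 := by simpa [unitDisk] using hw
    obtain ⟨v, hv, hwv⟩ := exists_norm_seriesFun_gt h0 hc hw1
    have hpos : 0 < ‖seriesFun c v‖ := (norm_nonneg w).trans_lt hwv
    refine ⟨Matrix.vecCons (w / seriesFun c v) (Matrix.vecCons v 0), fun i => ?_, ?_⟩
    · refine Fin.cases ?_ (fun i => Fin.cases ?_ (fun i => ?_) i) i
      · simpa [div_lt_one hpos] using hwv
      · simpa using hv
      · simp
    · simp [symbolMap, div_mul_cancel₀ w (norm_pos_iff.1 hpos)]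

theorem vecCons_zero_injective (M : ℕ) :
    Function.Injective fun m : ℕ => (Matrix.vecCons m 0 : Fin (M + 2) → ℕ) :=
  fun m m' h => by simpa using congrFun h 0

theorem vecCons_vecCons_zero_injective (M : ℕ) : Function.Injective fun x : ℕ × ℕ =>
    (Matrix.vecCons x.1 (Matrix.vecCons x.2 0) : Fin (M + 2) → ℕ) :=
  fun x x' h => Prod.ext (by simpa using congrFun h 0) (by simpa using congrFun h 1)

theorem eval_symbolMap {M : ℕ} (c : ℕ → ℝ) (a : H2poly (M + 2)) (z : Fin (M + 2) → ℂ) :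
    H2poly.eval a (symbolMap M c z) =
      ∑' m : ℕ, a (Matrix.vecCons m 0) * (z 0 * seriesFun c (z 1)) ^ m := by
  rw [H2poly.eval, ← (vecCons_zero_injective M).tsum_eq]
  · refine tsum_congr fun m => ?_
    simp [Fin.prod_univ_succ, symbolMap]
  · intro α hα
    refine ⟨α 0, funext fun i => ?_⟩
    refine Fin.cases (by simp) (fun i => ?_) i
    by_contra hne
    refine hα ?_
    have : ∏ i, symbolMap M c z i ^ α i = 0 := by
      refine Finset.prod_eq_zero (Finset.mem_univ i.succ) ?_
      have h : α i.succ ≠ 0 := fun h => hne (by simp [h])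
      simp [symbolMap, h]
    simp only [this, mul_zero]

theorem isCompOpPoly_symbolMap {M : ℕ} {c : ℕ → ℝ} (h0 : ∀ j, 0 ≤ c j) (hc : HasSum c 1)
    {T : H2poly (M + 2) →L[ℂ] H2poly (M + 2)}
    (hT : ∀ a, ⇑(T a) = Function.extend
      (fun x : ℕ × ℕ => (Matrix.vecCons x.1 (Matrix.vecCons x.2 0) : Fin (M + 2) → ℕ))
      (fun x => a (Matrix.vecCons x.1 0) * (powCoeff c x.1 x.2 : ℂ)) 0) :
    IsCompOpPoly (symbolMap M c) T := by
  intro a z hz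
  have hι := vecCons_vecCons_zero_injective M
  rw [eval_symbolMap, H2poly.eval, ← hι.tsum_eq]
  · have hterm : ∀ x : ℕ × ℕ, T a (Matrix.vecCons x.1 (Matrix.vecCons x.2 0)) *
        ∏ i, z i ^ (Matrix.vecCons x.1 (Matrix.vecCons x.2 0) : Fin (M + 2) → ℕ) i =
        a (Matrix.vecCons x.1 0) * z 0 ^ x.1 * ((powCoeff c x.1 x.2 : ℂ) * z 1 ^ x.2) := by
      intro x
      rw [hT, hι.extend_apply _ _ x]
      simp only [Fin.prod_univ_succ, Matrix.cons_val_zero, Matrix.cons_val_succ, Pi.zero_apply,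
        pow_zero, Finset.prod_const_one, mul_one, Fin.succ_zero_eq_one]
      ring
    simp only [hterm]
    have hsum : Summable fun x : ℕ × ℕ =>
        a (Matrix.vecCons x.1 0) * z 0 ^ x.1 * ((powCoeff c x.1 x.2 : ℂ) * z 1 ^ x.2) := by
      have hf : Summable fun m : ℕ => ‖a‖ * ‖z 0‖ ^ m :=
        (summable_geometric_of_lt_one (norm_nonneg _) (hz 0)).mul_left _
      have hg : Summable fun j : ℕ => ‖z 1‖ ^ j :=
        summable_geometric_of_lt_one (norm_nonneg _) (hz 1)
      refine Summable.of_norm_bounded (hf.mul_of_nonneg hg (fun _ => by positivity)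
        fun _ => by positivity) fun x => ?_
      rw [norm_mul, norm_mul, norm_mul, norm_pow, norm_pow, Complex.norm_real,
        Real.norm_of_nonneg (powCoeff_nonneg h0 _ _)]
      exact mul_le_mul
        (mul_le_mul_of_nonneg_right (lp.norm_apply_le_norm (by simp) a _) (by positivity))
        (mul_le_of_le_one_left (by positivity) (powCoeff_le_one h0 hc _ _))
        (mul_nonneg (powCoeff_nonneg h0 _ _) (by positivity)) (by positivity)
    have hfib : ∀ m : ℕ, HasSum (fun j => a (Matrix.vecCons m 0) * z 0 ^ m *
        ((powCoeff c m j : ℂ) * z 1 ^ j))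
        (a (Matrix.vecCons m 0) * z 0 ^ m * seriesFun c (z 1) ^ m) := fun m =>
      (powCoeff_hasSum h0 hc.summable (hz 1).le m).2.mul_left _
    rw [← (hsum.hasSum.prod_fiberwise hfib).tsum_eq]
    exact tsum_congr fun m => by rw [mul_pow, mul_assoc]
  · intro α hα
    by_contra hne
    exact hα (by simp [hT, Function.extend_apply' _ _ _ hne])

/-- The composition operator of `symbolMap M c`, with two-sided control of its approximation
numbers by the `ℓ²` norms of the coefficients of the powers of `ψ`. -/
theorem exists_compOp (M : ℕ) {c : ℕ → ℝ} (h0 : ∀ j, 0 ≤ c j) (hc : HasSum c 1) :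
    ∃ T : H2poly (M + 2) →L[ℂ] H2poly (M + 2), IsCompOpPoly (symbolMap M c) T ∧
      (∀ n B, (∀ j, powCoeff c n j ≤ B) → approxNum (n + 1) T ≤ √B) ∧
      ∀ n b, (∀ m, m ≤ n → b ^ 2 ≤ ∑' j, powCoeff c m j ^ 2) → b ≤ approxNum (n + 1) T := by
  have he := vecCons_zero_injective M
  obtain ⟨T, hT, hTs⟩ := exists_blockDiagonal he (vecCons_vecCons_zero_injective M)
    (powCoeff_sq_summable h0 hc) fun m => tsum_powCoeff_sq_le h0 hc (powCoeff_le_one h0 hc m)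
  refine ⟨T, isCompOpPoly_symbolMap h0 hc hT, fun n B hB => ?_, fun n b hb => ?_⟩
  · exact approxNum_le_of_hasSum he hTs ((powCoeff_nonneg h0 n 0).trans (hB 0)) fun m hm =>
      tsum_powCoeff_sq_le h0 hc (powCoeff_le_of_le h0 hc hB hm)
  · exact le_approxNum_of_hasSum he hTs hb

/-- The sequence `(1 + log (j + 1)) ^ (-k)`. -/
def logTail (k : ℝ) (j : ℕ) : ℝ := (1 + Real.log (j + 1)) ^ (-k)

/-- The probability weights with tails `logTail k`. -/
def logWeight (k : ℝ) (j : ℕ) : ℝ := logTail k j - logTail k (j + 1)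

theorem one_le_one_add_log (j : ℕ) : 1 ≤ 1 + Real.log ((j : ℝ) + 1) := by
  have : 0 ≤ Real.log ((j : ℝ) + 1) := Real.log_nonneg (by linarith [j.cast_nonneg (α := ℝ)])
  linarith

theorem logTail_zero (k : ℝ) : logTail k 0 = 1 := by simp [logTail]

theorem logTail_nonneg (k : ℝ) (j : ℕ) : 0 ≤ logTail k j :=
  Real.rpow_nonneg (zero_le_one.trans (one_le_one_add_log j)) _

theorem logWeight_nonneg {k : ℝ} (hk : 0 < k) (j : ℕ) : 0 ≤ logWeight k j := by
  refine sub_nonneg.2 (Real.rpow_le_rpow_of_nonpos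
    (zero_lt_one.trans_le (one_le_one_add_log j)) ?_ (by linarith))
  push_cast
  gcongr
  linarith

theorem sum_logWeight (k : ℝ) (M : ℕ) :
    ∑ j ∈ Finset.range M, logWeight k j = 1 - logTail k M := by
  simp only [logWeight]
  rw [Finset.sum_range_sub', logTail_zero]

theorem logWeight_hasSum {k : ℝ} (hk : 0 < k) : HasSum (logWeight k) 1 := by
  rw [hasSum_iff_tendsto_nat_of_nonneg (logWeight_nonneg hk)]
  simp only [sum_logWeight]
  have h : Tendsto (fun j : ℕ => 1 + Real.log ((j : ℝ) + 1)) atTop atTop :=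
    tendsto_atTop_add_const_left _ _ (Real.tendsto_log_atTop.comp
      (tendsto_atTop_add_const_right _ _ tendsto_natCast_atTop_atTop))
  simpa [logTail] using ((tendsto_rpow_neg_atTop hk).comp h).const_sub 1

theorem logWeight_le {k : ℝ} (hk : 0 < k) (j : ℕ) : logWeight k j ≤ k / ((j : ℝ) + 1) := by
  have hj : (0 : ℝ) < (j : ℝ) + 1 := by positivity
  set a := 1 + Real.log ((j : ℝ) + 1) with ha
  set b := 1 + Real.log ((j : ℝ) + 1 + 1) with hb
  have ha1 : 1 ≤ a := one_le_one_add_log j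
  have hb1 : 1 ≤ b := by simpa [hb] using one_le_one_add_log (j + 1)
  have ha0 : 0 < a := by linarith
  have hb0 : 0 < b := by linarith
  have hab : b - a ≤ 1 / ((j : ℝ) + 1) := by
    have h1 : b - a = Real.log (((j : ℝ) + 1 + 1) / ((j : ℝ) + 1)) := by
      rw [Real.log_div (by positivity) hj.ne', ha, hb]; ring
    rw [h1]
    refine (Real.log_le_sub_one_of_pos (by positivity)).trans (le_of_eq ?_)
    field_simp
    ring
  have hle : a ≤ b := by
    rw [ha, hb]; gcongr; linarith
  have hlog : Real.log b - Real.log a ≤ b - a := by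
    rw [← Real.log_div hb0.ne' ha0.ne']
    refine (Real.log_le_sub_one_of_pos (by positivity)).trans ?_
    rw [div_sub_one ha0.ne']
    exact div_le_self (by linarith) ha1
  have hea : a ^ (-k) ≤ 1 := Real.rpow_le_one_of_one_le_of_nonpos ha1 (by linarith)
  have hprod : b ^ (-k) = a ^ (-k) * Real.exp (-(k * (Real.log b - Real.log a))) := by
    rw [Real.rpow_def_of_pos hb0, Real.rpow_def_of_pos ha0, ← Real.exp_add]
    congr 1; ring
  have hexp := Real.add_one_le_exp (-(k * (Real.log b - Real.log a)))
  have hlog0 : 0 ≤ Real.log b - Real.log a := sub_nonneg.2 (Real.log_le_log ha0 hle)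
  have hW : logWeight k j = a ^ (-k) - b ^ (-k) := by
    simp only [logWeight, logTail, ha, hb]; push_cast; rfl
  rw [hW, hprod]
  calc a ^ (-k) - a ^ (-k) * Real.exp (-(k * (Real.log b - Real.log a)))
      = a ^ (-k) * (1 - Real.exp (-(k * (Real.log b - Real.log a)))) := by ring
    _ ≤ a ^ (-k) * (k * (Real.log b - Real.log a)) :=
        mul_le_mul_of_nonneg_left (by linarith) (by positivity)
    _ ≤ k * (Real.log b - Real.log a) := mul_le_of_le_one_left (by positivity) hea
    _ ≤ k * (1 / ((j : ℝ) + 1)) := by gcongr; linarith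
    _ = k / ((j : ℝ) + 1) := by ring

theorem tendsto_succ_rpow_atTop {s : ℝ} (hs : 0 < s) :
    Tendsto (fun n : ℕ => ((n : ℝ) + 1) ^ s) atTop atTop :=
  (tendsto_rpow_atTop hs).comp (tendsto_atTop_add_const_right _ _ tendsto_natCast_atTop_atTop)

theorem ceil_exp_add_one_le {X : ℝ} (hX : 1 ≤ X) :
    ((⌈Real.exp X⌉₊ : ℕ) : ℝ) + 1 ≤ Real.exp (X + 2) := by
  have h1 := (Nat.ceil_lt_add_one (Real.exp_pos X).le).le
  have h2 : 1 ≤ Real.exp X := Real.one_le_exp (by linarith)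
  have h3 : 3 ≤ Real.exp 2 := by linarith [Real.add_one_le_exp (2 : ℝ)]
  rw [Real.exp_add]
  nlinarith

theorem le_logTail_ceil_exp {k X : ℝ} (hk : 0 < k) (hX : 1 ≤ X) :
    (4 * X) ^ (-k) ≤ logTail k ⌈Real.exp X⌉₊ := by
  refine Real.rpow_le_rpow_of_nonpos (zero_lt_one.trans_le (one_le_one_add_log _)) ?_ (by linarith)
  have := Real.log_le_log (by positivity) (ceil_exp_add_one_le hX)
  rw [Real.log_exp] at this
  linarith

theorem logTail_ceil_exp_le {k X : ℝ} (hk : 0 < k) (hX : 1 ≤ X) :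
    logTail k ⌈Real.exp X⌉₊ ≤ X ^ (-k) := by
  refine Real.rpow_le_rpow_of_nonpos (by linarith) ?_ (by linarith)
  have := Real.log_le_log (Real.exp_pos X)
    ((Nat.le_ceil (Real.exp X)).trans (le_add_of_nonneg_right zero_le_one))
  rw [Real.log_exp] at this
  linarith

theorem succ_rpow_inv_rpow {k : ℝ} (hk : 0 < k) (n : ℕ) :
    (((n : ℝ) + 1) ^ (1 / (k + 1))) ^ (k + 1) = (n : ℝ) + 1 := by
  rw [one_div, Real.rpow_inv_rpow (by positivity) (by positivity)]

/-- Upper bound `exp (-C n ^ (1 / (k + 1)))` for the coefficients of the `n`-th power. -/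
theorem exists_powCoeff_logWeight_le {k : ℝ} (hk : 0 < k) : ∃ C : ℝ, 0 < C ∧
    ∀ᶠ n : ℕ in atTop, ∀ j, powCoeff (logWeight k) n j ≤
      Real.exp (-(C * ((n : ℝ) + 1) ^ (1 / (k + 1)))) := by
  set d : ℝ := 4 ^ (-k) / 2 with hd
  have hd0 : 0 < d := by positivity
  have hd1 : d ≤ 1 / 2 := by
    have : (4 : ℝ) ^ (-k) ≤ 1 := Real.rpow_le_one_of_one_le_of_nonpos (by norm_num) (by linarith)
    linarith
  have hX := tendsto_succ_rpow_atTop (s := 1 / (k + 1)) (by positivity)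
  have hlim : Tendsto (fun X : ℝ => X ^ (0 : ℝ) * Real.exp (-(d / 2) * X) +
      k * (X ^ (k + 1) * Real.exp (-(1 - d / 2) * X))) atTop (𝓝 (0 + k * 0)) :=
    (tendsto_rpow_mul_exp_neg_mul_atTop_nhds_zero 0 _ (by linarith)).add
      ((tendsto_rpow_mul_exp_neg_mul_atTop_nhds_zero (k + 1) _ (by linarith)).const_mul k)
  rw [mul_zero, add_zero] at hlim
  refine ⟨d / 2, by positivity, ?_⟩
  filter_upwards [hX.eventually (hlim.eventually_le_const one_pos), hX.eventually_ge_atTop 1,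
    eventually_ge_atTop 1] with n hn hX1 hn1 j
  have hnX := succ_rpow_inv_rpow hk n
  set X := ((n : ℝ) + 1) ^ (1 / (k + 1))
  set M := ⌈Real.exp X⌉₊
  have hX0 : 0 < X := by linarith
  have hn1' : (1 : ℝ) ≤ n := by exact_mod_cast hn1
  have hMX : Real.exp X ≤ (M : ℝ) + 1 :=
    (Nat.le_ceil (Real.exp X)).trans (le_add_of_nonneg_right zero_le_one)
  have hcoef := powCoeff_le (logWeight_nonneg hk) (logWeight_hasSum hk) (M := M)
    (b := k / ((M : ℝ) + 1)) (by positivity) (fun i hi => (logWeight_le hk i).trans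
      (by gcongr)) n j
  have hT0 := logTail_nonneg k M
  have hT := le_logTail_ceil_exp hk hX1
  rw [sum_logWeight] at hcoef
  have hT1 : 0 ≤ 1 - logTail k M := by
    rw [← sum_logWeight]
    exact Finset.sum_nonneg fun i _ => logWeight_nonneg hk i
  have hnT : d * X ≤ n * logTail k M := by
    have h1 : (4 * X) ^ (-k) = 4 ^ (-k) * X ^ (-k) := Real.mul_rpow (by norm_num) hX0.le
    have h2 : X ^ (k + 1) * X ^ (-k) = X := by
      rw [← Real.rpow_add hX0]; simp
    calc d * X = (X ^ (k + 1) / 2) * (4 * X) ^ (-k) := by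
          rw [h1, hd]; linear_combination (-(4 : ℝ) ^ (-k) / 2) * h2
      _ ≤ n * logTail k M := by
          rw [hnX]
          exact mul_le_mul (by linarith) hT (by positivity) (by positivity)
  have hfirst : (1 - logTail k M) ^ n ≤ Real.exp (-(d * X)) := by
    calc (1 - logTail k M) ^ n ≤ Real.exp (-logTail k M) ^ n := by
          refine pow_le_pow_left₀ hT1 ?_ n
          linarith [Real.add_one_le_exp (-logTail k M)]
      _ = Real.exp (-(n * logTail k M)) := by rw [← Real.exp_nat_mul]; congr 1; ring
      _ ≤ Real.exp (-(d * X)) := Real.exp_le_exp.2 (by linarith)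
  have hsecond : n * (k / ((M : ℝ) + 1)) ≤ k * (X ^ (k + 1) * Real.exp (-X)) := by
    rw [hnX, Real.exp_neg, ← div_eq_mul_inv]
    calc n * (k / ((M : ℝ) + 1)) ≤ ((n : ℝ) + 1) * (k / Real.exp X) := by
          gcongr
          linarith
      _ = k * (((n : ℝ) + 1) / Real.exp X) := by ring
  refine hcoef.trans ((add_le_add hfirst hsecond).trans ?_)
  have hfac : Real.exp (-(d * X)) + k * (X ^ (k + 1) * Real.exp (-X)) =
      Real.exp (-(d / 2 * X)) * (X ^ (0 : ℝ) * Real.exp (-(d / 2) * X) +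
      k * (X ^ (k + 1) * Real.exp (-(1 - d / 2) * X))) := by
    have e1 : Real.exp (-(d * X)) = Real.exp (-(d / 2 * X)) * Real.exp (-(d / 2) * X) := by
      rw [← Real.exp_add]; congr 1; ring
    have e2 : Real.exp (-X) = Real.exp (-(d / 2 * X)) * Real.exp (-(1 - d / 2) * X) := by
      rw [← Real.exp_add]; congr 1; ring
    rw [e1, e2, Real.rpow_zero]; ring
  rw [hfac]
  exact mul_le_of_le_one_right (Real.exp_pos _).le hn

/-- Lower bound `exp (-C n ^ (1 / (k + 1)))` for the `ℓ²` norms of the first powers. -/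
theorem exists_le_tsum_powCoeff_logWeight_sq {k : ℝ} (hk : 0 < k) : ∃ C : ℝ, 0 < C ∧
    ∀ᶠ n : ℕ in atTop, ∀ m, m ≤ n → Real.exp (-(C * ((n : ℝ) + 1) ^ (1 / (k + 1)))) ^ 2 ≤
      ∑' j, powCoeff (logWeight k) m j ^ 2 := by
  have hX := tendsto_succ_rpow_atTop (s := 1 / (k + 1)) (by positivity)
  refine ⟨k + 11, by linarith, ?_⟩
  filter_upwards [hX.eventually ((tendsto_rpow_neg_atTop hk).eventually_le_const
    (show (0 : ℝ) < 1 / 2 by norm_num)), hX.eventually_ge_atTop 1] with n hn hX1 m hm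
  have hnX := succ_rpow_inv_rpow hk n
  set X := ((n : ℝ) + 1) ^ (1 / (k + 1))
  set M := ⌈Real.exp X⌉₊
  have hX0 : 0 < X := by linarith
  have hn0 : (0 : ℝ) ≤ n := n.cast_nonneg
  have hM0 : (0 : ℝ) ≤ M := M.cast_nonneg
  set T := logTail k M with hTdef
  have hT0 : 0 ≤ T := logTail_nonneg k M
  have hTX : T ≤ X ^ (-k) := logTail_ceil_exp_le hk hX1
  have hT1 : T ≤ 1 / 2 := hTX.trans hn
  set δ : ℝ := 1 / (2 * ((n : ℝ) + 1) * ((M : ℝ) + 1)) with hδ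
  have hδ0 : 0 < δ := by positivity
  have hδ1 : δ ≤ 1 / 2 := by
    rw [hδ]
    apply one_div_le_one_div_of_le (by norm_num)
    nlinarith
  have hx0 : 0 ≤ 1 - δ := by linarith
  have hy0 : 0 ≤ (1 - T) * (1 - δ) ^ M := mul_nonneg (by linarith) (pow_nonneg hx0 M)
  have hy1 : (1 - T) * (1 - δ) ^ M ≤ 1 :=
    mul_le_one₀ (by linarith) (pow_nonneg hx0 M) (pow_le_one₀ hx0 (by linarith))
  have hmain := le_tsum_powCoeff_sq (logWeight_nonneg hk) (logWeight_hasSum hk) hx0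
    (by linarith : 1 - δ < 1) hy0 (M := M) (by rw [sum_logWeight]) m
  refine le_trans ?_ hmain
  rw [sub_sub_cancel]
  have hpowm : ((1 - T) * (1 - δ) ^ M) ^ n ≤ ((1 - T) * (1 - δ) ^ M) ^ m :=
    pow_le_pow_of_le_one hy0 hy1 hm
  have hnT : n * T ≤ X := by
    have h2 : X ^ (k + 1) * X ^ (-k) = X := by
      rw [← Real.rpow_add hX0]; simp
    calc n * T ≤ ((n : ℝ) + 1) * X ^ (-k) := by gcongr; linarith
      _ = X := by rw [← hnX, h2]
  have hA : Real.exp (-(2 * X)) ≤ (1 - T) ^ n := by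
    have hlog : -(2 * T) ≤ Real.log (1 - T) := by
      refine le_trans ?_ (Real.one_sub_inv_le_log_of_pos (by linarith))
      have : (1 - T)⁻¹ ≤ 1 + 2 * T := by
        rw [inv_le_iff_one_le_mul₀ (by linarith)]
        nlinarith
      linarith
    have h1 : Real.exp (-(2 * T)) ≤ 1 - T := by
      rwa [← Real.le_log_iff_exp_le (by linarith)]
    calc Real.exp (-(2 * X)) ≤ Real.exp (-(2 * T)) ^ n := by
          rw [← Real.exp_nat_mul]
          exact Real.exp_le_exp.2 (by linarith)
      _ ≤ (1 - T) ^ n := pow_le_pow_left₀ (Real.exp_pos _).le h1 n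
  have hB : 1 / 2 ≤ ((1 - δ) ^ M) ^ n := by
    rw [← pow_mul]
    have := one_add_mul_le_pow (a := -δ) (by linarith) (M * n)
    rw [← sub_eq_add_neg] at this
    refine le_trans ?_ this
    have hle : (M : ℝ) * n * δ ≤ 1 / 2 := by
      rw [hδ, mul_one_div, div_le_iff₀ (by positivity)]
      nlinarith
    push_cast
    linarith
  have hyn : Real.exp (-(2 * X)) * (1 / 2) ≤ ((1 - T) * (1 - δ) ^ M) ^ m := by
    refine le_trans ?_ hpowm
    rw [mul_pow]
    exact mul_le_mul hA hB (by norm_num) (pow_nonneg (by linarith) n)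
  have hδX : Real.exp (-((k + 1) * X)) * Real.exp (-(X + 2)) * (1 / 2) ≤ δ := by
    have h1 : (n : ℝ) + 1 ≤ Real.exp ((k + 1) * X) := by
      rw [← hnX, Real.rpow_def_of_pos hX0]
      refine Real.exp_le_exp.2 ?_
      rw [mul_comm]
      have := Real.log_le_sub_one_of_pos hX0
      gcongr
      linarith
    have h2 : (M : ℝ) + 1 ≤ Real.exp (X + 2) := ceil_exp_add_one_le hX1
    rw [Real.exp_neg, Real.exp_neg, hδ]
    calc (Real.exp ((k + 1) * X))⁻¹ * (Real.exp (X + 2))⁻¹ * (1 / 2)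
        = 1 / (2 * Real.exp ((k + 1) * X) * Real.exp (X + 2)) := by
          rw [one_div, one_div, mul_inv, mul_inv]; ring
      _ ≤ 1 / (2 * ((n : ℝ) + 1) * ((M : ℝ) + 1)) := by gcongr
  have he3 : (1 / 8 : ℝ) ≥ Real.exp (-3) := by
    have h1 : (2 : ℝ) ≤ Real.exp 1 := by linarith [Real.add_one_le_exp (1 : ℝ)]
    have h3 : (8 : ℝ) ≤ Real.exp 3 := by
      have : Real.exp 3 = Real.exp 1 ^ 3 := by rw [← Real.exp_nat_mul]; norm_num
      rw [this]
      calc (8 : ℝ) = 2 ^ 3 := by norm_num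
        _ ≤ _ := by gcongr
    rw [Real.exp_neg, ← one_div]
    exact one_div_le_one_div_of_le (by norm_num) h3
  calc Real.exp (-((k + 11) * X)) ^ 2
      ≤ Real.exp (-(2 * X)) ^ 2 * (Real.exp (-((k + 1) * X)) * Real.exp (-(X + 2))) *
          Real.exp (-3) := by
        rw [← Real.exp_nat_mul, ← Real.exp_nat_mul, ← Real.exp_add, ← Real.exp_add, ← Real.exp_add]
        refine Real.exp_le_exp.2 ?_
        push_cast
        nlinarith
    _ ≤ Real.exp (-(2 * X)) ^ 2 * (Real.exp (-((k + 1) * X)) * Real.exp (-(X + 2))) * (1 / 8) := by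
        gcongr
    _ = (Real.exp (-(2 * X)) * (1 / 2)) ^ 2 *
          (Real.exp (-((k + 1) * X)) * Real.exp (-(X + 2)) * (1 / 2)) := by ring
    _ ≤ (((1 - T) * (1 - δ) ^ M) ^ m) ^ 2 * δ := by gcongr

theorem exp_neg_mul_rpow_inv (C : ℝ) {X : ℝ} (hX : 0 < X) :
    Real.exp (-(C * X)) ^ (1 / X) = Real.exp (-C) := by
  rw [← Real.exp_mul]
  congr 1
  field_simp

/-- The composition operator attached to `logWeight k` has approximation numbers at most
`exp (-C n ^ (1 / (k + 1)))` and is compact. -/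
theorem exists_compOp_logWeight (M : ℕ) {k : ℝ} (hk : 0 < k) :
    ∃ T : H2poly (M + 2) →L[ℂ] H2poly (M + 2), IsCompOpPoly (symbolMap M (logWeight k)) T ∧
      IsCompactOperator ⇑T ∧
      (∃ C : ℝ, 0 < C ∧ ∀ᶠ n : ℕ in atTop,
        approxNum (n + 1) T ≤ Real.exp (-(C * ((n : ℝ) + 1) ^ (1 / (k + 1))))) ∧
      ∃ C : ℝ, 0 < C ∧ ∀ᶠ n : ℕ in atTop,
        Real.exp (-(C * ((n : ℝ) + 1) ^ (1 / (k + 1)))) ≤ approxNum (n + 1) T := by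
  obtain ⟨T, hT, hup, hlow⟩ := exists_compOp M (logWeight_nonneg hk) (logWeight_hasSum hk)
  obtain ⟨C, hC, hCn⟩ := exists_powCoeff_logWeight_le hk
  obtain ⟨C', hC', hCn'⟩ := exists_le_tsum_powCoeff_logWeight_sq hk
  have hle : ∀ᶠ n : ℕ in atTop,
      approxNum (n + 1) T ≤ Real.exp (-(C / 2 * ((n : ℝ) + 1) ^ (1 / (k + 1)))) := by
    filter_upwards [hCn] with n hn
    refine (hup n _ hn).trans (le_of_eq ?_)
    rw [Real.sqrt_eq_iff_mul_self_eq (Real.exp_pos _).le (Real.exp_pos _).le, ← Real.exp_add]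
    congr 1
    ring
  refine ⟨T, hT, isCompactOperator_of_tendsto_approxNum ?_, ⟨C / 2, half_pos hC, hle⟩,
    C', hC', hCn'.mono fun n hn => hlow n _ hn⟩
  refine tendsto_of_tendsto_of_tendsto_of_le_of_le' tendsto_const_nhds ?_
    (Eventually.of_forall fun n => approxNum_nonneg _ _) hle
  exact Real.tendsto_exp_neg_atTop_nhds_zero.comp
    ((tendsto_succ_rpow_atTop (by positivity)).const_mul_atTop (half_pos hC))

/-- for `N ≥ 2` there are analytic `Φ₁, Φ₂ : 𝔻^N → 𝔻^N` with the same
image such that `C_{Φ₁}` is compact on `H²(𝔻^N)` with `β_N⁻(C_{Φ₁}) > 0` and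
`β_N⁺(C_{Φ₁}) < 1`, while `C_{Φ₂}` is compact with `β_N(C_{Φ₂}) = 0`. -/
theorem stmt_16 (N : ℕ) (hN : 2 ≤ N) :
    ∃ Φ₁ Φ₂ : (Fin N → ℂ) → (Fin N → ℂ),
      Set.MapsTo Φ₁ (polyDisk N) (polyDisk N) ∧ Set.MapsTo Φ₂ (polyDisk N) (polyDisk N) ∧
      DifferentiableOn ℂ Φ₁ (polyDisk N) ∧ DifferentiableOn ℂ Φ₂ (polyDisk N) ∧
      Φ₁ '' polyDisk N = Φ₂ '' polyDisk N ∧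
      (∃ T₁ : H2poly N →L[ℂ] H2poly N, IsCompOpPoly Φ₁ T₁ ∧ IsCompactOperator ⇑T₁ ∧
        0 < Filter.liminf
          (fun n : ℕ => approxNum (n + 1) T₁ ^ (1 / ((n : ℝ) + 1) ^ (1 / (N : ℝ))))
          Filter.atTop ∧
        Filter.limsup
          (fun n : ℕ => approxNum (n + 1) T₁ ^ (1 / ((n : ℝ) + 1) ^ (1 / (N : ℝ))))
          Filter.atTop < 1) ∧
      ∃ T₂ : H2poly N →L[ℂ] H2poly N, IsCompOpPoly Φ₂ T₂ ∧ IsCompactOperator ⇑T₂ ∧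
        Filter.Tendsto
          (fun n : ℕ => approxNum (n + 1) T₂ ^ (1 / ((n : ℝ) + 1) ^ (1 / (N : ℝ))))
          Filter.atTop (nhds 0) := by
  obtain ⟨M, rfl⟩ : ∃ M, N = M + 2 := ⟨N - 2, by omega⟩
  have hk₁ : (0 : ℝ) < (M : ℝ) + 1 := by positivity
  have hk₂ : (0 : ℝ) < 1 / 2 := by norm_num
  have hN : ((M + 2 : ℕ) : ℝ) = (M : ℝ) + 1 + 1 := by push_cast; ring
  obtain ⟨T₁, hT₁, hc₁, ⟨C, hC, hup⟩, C', hC', hlow⟩ := exists_compOp_logWeight M hk₁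
  obtain ⟨T₂, hT₂, hc₂, ⟨D, hD, hup₂⟩, -⟩ := exists_compOp_logWeight M hk₂
  refine ⟨symbolMap M (logWeight ((M : ℝ) + 1)), symbolMap M (logWeight (1 / 2)),
    mapsTo_symbolMap M (logWeight_nonneg hk₁) (logWeight_hasSum hk₁),
    mapsTo_symbolMap M (logWeight_nonneg hk₂) (logWeight_hasSum hk₂),
    differentiableOn_symbolMap M (logWeight_nonneg hk₁) (logWeight_hasSum hk₁),
    differentiableOn_symbolMap M (logWeight_nonneg hk₂) (logWeight_hasSum hk₂), ?_,
    ⟨T₁, hT₁, hc₁, ?_⟩, T₂, hT₂, hc₂, ?_⟩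
  · rw [image_symbolMap M (logWeight_nonneg hk₁) (logWeight_hasSum hk₁),
      image_symbolMap M (logWeight_nonneg hk₂) (logWeight_hasSum hk₂)]
  · rw [hN]
    set f : ℕ → ℝ := fun n =>
      approxNum (n + 1) T₁ ^ (1 / ((n : ℝ) + 1) ^ (1 / ((M : ℝ) + 1 + 1)))
    have hfup : ∀ᶠ n in atTop, f n ≤ Real.exp (-C) := by
      filter_upwards [hup] with n hn
      rw [← exp_neg_mul_rpow_inv C (X := ((n : ℝ) + 1) ^ (1 / ((M : ℝ) + 1 + 1))) (by positivity)]
      exact Real.rpow_le_rpow (approxNum_nonneg _ _) hn (by positivity)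
    have hflow : ∀ᶠ n in atTop, Real.exp (-C') ≤ f n := by
      filter_upwards [hlow] with n hn
      rw [← exp_neg_mul_rpow_inv C' (X := ((n : ℝ) + 1) ^ (1 / ((M : ℝ) + 1 + 1))) (by positivity)]
      exact Real.rpow_le_rpow (Real.exp_pos _).le hn (by positivity)
    have hbdd : IsBoundedUnder (· ≤ ·) atTop f := isBoundedUnder_of_eventually_le hfup
    have hbdd' : IsBoundedUnder (· ≥ ·) atTop f := isBoundedUnder_of_eventually_ge hflow
    exact ⟨(Real.exp_pos _).trans_le (le_liminf_of_le hbdd.isCoboundedUnder_ge hflow),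
      (limsup_le_of_le hbdd'.isCoboundedUnder_le hfup).trans_lt
        (by simpa using hC)⟩
  · rw [hN]
    have hs : 0 < 1 / ((1 : ℝ) / 2 + 1) - 1 / ((M : ℝ) + 1 + 1) := by
      rw [sub_pos]
      exact one_div_lt_one_div_of_lt (by norm_num) (by linarith [M.cast_nonneg (α := ℝ)])
    refine tendsto_of_tendsto_of_tendsto_of_le_of_le' tendsto_const_nhds
      (Real.tendsto_exp_neg_atTop_nhds_zero.comp
        ((tendsto_succ_rpow_atTop hs).const_mul_atTop hD))
      (Eventually.of_forall fun n => Real.rpow_nonneg (approxNum_nonneg _ _) _) ?_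
    filter_upwards [hup₂] with n hn
    refine (Real.rpow_le_rpow (approxNum_nonneg _ _) hn (by positivity)).trans (le_of_eq ?_)
    rw [← Real.exp_mul, Function.comp_apply, Real.rpow_sub (by positivity)]
    congr 1
    ring

end
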